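/- arXiv:2504.09360 — 2 statements merged into one kernel-verified Lean document; each statement's English description precedes it below -/
import Mathlib

section
/- Let U be a unitary on N qubits such that for every Pauli string P, the conjugate U† P U is a product operator X_P ⊗ Y_P across a bipartition into N_A and N_B qubits. Then there exist unitaries V on (ℂ²)^{⊗N_A}, W on (ℂ²)^{⊗N_B}, and a Clifford unitary C on N qubits such that U† = (V ⊗ W)·C. -/
open Matrix Kronecker

/-- The four single-qubit Pauli matrices `I, X, Y, Z`. -/
noncomputable def pauli : Fin 4 → Matrix (Fin 2) (Fin 2) ℂ :=
  ![1, !![0, 1; 1, 0], !![0, -Complex.I; Complex.I, 0], !![1, 0; 0, -1]]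

/-- A Pauli string: the tensor product over the sites `i : ι` of the single-qubit
Pauli matrices `pauli (a i)`. -/
noncomputable def pauliString {ι : Type*} [Fintype ι] (a : ι → Fin 4) :
    Matrix (ι → Fin 2) (ι → Fin 2) ℂ :=
  Matrix.of fun x y => ∏ i, pauli (a i) (x i) (y i)
/-- The partial swap `T^A₁₂` on the doubled space, swapping the two copies of
subsystem `A` and acting as the identity on the two copies of `B`. -/
noncomputable def swapA (α β : Type*) [DecidableEq α] [DecidableEq β] :
    Matrix ((α × β) × (α × β)) ((α × β) × (α × β)) ℂ :=
  Matrix.of fun p q =>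
    if p.1.1 = q.2.1 ∧ p.2.1 = q.1.1 ∧ p.1.2 = q.1.2 ∧ p.2.2 = q.2.2 then 1 else 0

/-- The linear operator entanglement
`E_lin(O) = 1 - d⁻² Tr(T^A₁₂ O^{⊗2} T^A₁₂ (O†)^{⊗2})`, `d = dim(H_A ⊗ H_B)`. -/
noncomputable def ElinC {α β : Type*} [Fintype α] [Fintype β] [DecidableEq α] [DecidableEq β]
    (O : Matrix (α × β) (α × β) ℂ) : ℂ :=
  1 - (((Fintype.card α : ℂ) * (Fintype.card β : ℂ)) ^ 2)⁻¹ *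
    (swapA α β * (O ⊗ₖ O) * swapA α β * (Oᴴ ⊗ₖ Oᴴ)).trace
/-- An `N = N_A + N_B` qubit Pauli string, written as a product operator across the
bipartition into the first `N_A` and the last `N_B` qubits. -/
noncomputable def pauliP {NA NB : ℕ} (a : Fin NA → Fin 4) (b : Fin NB → Fin 4) :
    Matrix ((Fin NA → Fin 2) × (Fin NB → Fin 2)) ((Fin NA → Fin 2) × (Fin NB → Fin 2)) ℂ :=
  pauliString a ⊗ₖ pauliString b

/-- A Clifford unitary on `N = N_A + N_B` qubits: a unitary mapping every Pauli string
to a Pauli string up to a sign, under conjugation. -/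
def IsCliffordP {NA NB : ℕ}
    (C : Matrix ((Fin NA → Fin 2) × (Fin NB → Fin 2)) ((Fin NA → Fin 2) × (Fin NB → Fin 2)) ℂ) :
    Prop :=
  C ∈ Matrix.unitaryGroup ((Fin NA → Fin 2) × (Fin NB → Fin 2)) ℂ ∧
    ∀ (a : Fin NA → Fin 4) (b : Fin NB → Fin 4),
      ∃ (a' : Fin NA → Fin 4) (b' : Fin NB → Fin 4) (s : ℂ), (s = 1 ∨ s = -1) ∧
        C * pauliP a b * Cᴴ = s • pauliP a' b'

open Matrix Kronecker

def pmul : Fin 4 → Fin 4 → Fin 4 :=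
  ![![0, 1, 2, 3], ![1, 0, 3, 2], ![2, 3, 0, 1], ![3, 2, 1, 0]]

noncomputable def pph : Fin 4 → Fin 4 → ℂ :=
  ![![1, 1, 1, 1], ![1, 1, Complex.I, -Complex.I], ![1, -Complex.I, 1, Complex.I],
    ![1, Complex.I, -Complex.I, 1]]

lemma pauli_mul (i j : Fin 4) : pauli i * pauli j = pph i j • pauli (pmul i j) := by
  fin_cases i <;> fin_cases j <;> ext x y <;> fin_cases x <;> fin_cases y <;>
    simp [pauli, pph, pmul, Matrix.mul_apply, Fin.sum_univ_two]

lemma pauli_herm (i : Fin 4) (x y : Fin 2) : star (pauli i y x) = pauli i x y := by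
  fin_cases i <;> fin_cases x <;> fin_cases y <;> simp [pauli]

lemma pauli_complete (x y z w : Fin 2) :
    ∑ j, pauli j x y * star (pauli j z w) = 2 * if x = z ∧ y = w then 1 else 0 := by
  fin_cases x <;> fin_cases y <;> fin_cases z <;> fin_cases w <;>
    norm_num [pauli, Fin.sum_univ_succ]

lemma pph_norm (i j : Fin 4) : star (pph i j) * pph i j = 1 := by
  fin_cases i <;> fin_cases j <;> simp [pph]

lemma pph_symm (i j : Fin 4) : pph i j = pph j i ∨ pph i j = - pph j i := by
  fin_cases i <;> fin_cases j <;> simp [pph]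

lemma pmul_comm (i j : Fin 4) : pmul i j = pmul j i := by
  revert i j; decide

lemma pmul_pmul (i j : Fin 4) : pmul i (pmul i j) = j := by
  revert i j; decide

lemma pmul_self (i : Fin 4) : pmul i i = 0 := by
  revert i; decide

lemma pph_self (i : Fin 4) : pph i i = 1 := by
  fin_cases i <;> simp [pph]

section strings
variable {ι : Type*} [Fintype ι]

lemma ps_mul [DecidableEq ι] (a b : ι → Fin 4) : pauliString a * pauliString b
    = (∏ i, pph (a i) (b i)) • pauliString (fun i => pmul (a i) (b i)) := by
  ext x y
  simp only [pauliString, Matrix.mul_apply, Matrix.of_apply, Matrix.smul_apply, smul_eq_mul,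
    ← Finset.prod_mul_distrib]
  rw [← Fintype.prod_sum (fun i j => pauli (a i) (x i) j * pauli (b i) j (y i))]
  refine Finset.prod_congr rfl fun i _ => ?_
  have := congrFun (congrFun (pauli_mul (a i) (b i)) (x i)) (y i)
  simpa [Matrix.mul_apply] using this

lemma ps_herm (a : ι → Fin 4) : (pauliString a)ᴴ = pauliString a := by
  ext x y
  simp only [pauliString, Matrix.conjTranspose_apply, Matrix.of_apply, star_prod]
  exact Finset.prod_congr rfl fun i _ => pauli_herm _ _ _

lemma ps_zero [DecidableEq ι] : pauliString (fun _ : ι => (0 : Fin 4)) = 1 := by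
  ext x y
  simp only [pauliString, Matrix.of_apply, pauli, Matrix.cons_val_zero, Matrix.one_apply]
  rw [Finset.prod_ite_zero]
  simp [funext_iff]

lemma ps_sq [DecidableEq ι] (a : ι → Fin 4) : pauliString a * pauliString a = 1 := by
  rw [ps_mul]; simp [pmul_self, pph_self, ps_zero]

lemma ps_comm [DecidableEq ι] (a b : ι → Fin 4) :
    pauliString a * pauliString b = pauliString b * pauliString a ∨
    pauliString a * pauliString b = - (pauliString b * pauliString a) := by
  have h : (∏ i, pph (a i) (b i)) = (∏ i, pph (b i) (a i)) ∨
      (∏ i, pph (a i) (b i)) = - (∏ i, pph (b i) (a i)) := by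
    induction (Finset.univ : Finset ι) using Finset.induction_on with
    | empty => simp
    | insert i s hi ih =>
      rw [Finset.prod_insert hi, Finset.prod_insert hi]
      rcases ih with ih | ih <;> rcases pph_symm (a i) (b i) with h | h <;> rw [ih, h] <;> simp
  have hc : (fun i => pmul (a i) (b i)) = fun i => pmul (b i) (a i) :=
    funext fun i => pmul_comm _ _
  rw [ps_mul, ps_mul, hc]
  rcases h with h | h
  · left; rw [h]
  · right; rw [h, neg_smul]

lemma ps_complete [DecidableEq ι] (x y z w : ι → Fin 2) :
    ∑ a : ι → Fin 4, pauliString a x y * star (pauliString a z w)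
      = 2 ^ Fintype.card ι * if x = z ∧ y = w then 1 else 0 := by
  simp only [pauliString, Matrix.of_apply, star_prod, ← Finset.prod_mul_distrib]
  rw [← Fintype.prod_sum (fun i j => pauli j (x i) (y i) * star (pauli j (z i) (w i)))]
  simp only [pauli_complete, Finset.prod_mul_distrib, Finset.prod_const, Finset.card_univ]
  rw [Finset.prod_ite_zero]
  simp [funext_iff, forall_and]

lemma ps_phase (a b : ι → Fin 4) :
    star (∏ i, pph (a i) (b i)) * (∏ i, pph (a i) (b i)) = 1 := by
  rw [star_prod, ← Finset.prod_mul_distrib]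
  exact Finset.prod_eq_one fun i _ => pph_norm _ _

end strings

lemma scalar_of_complete {I D : Type*} [Fintype I] [Fintype D] [DecidableEq D]
    (P : I → Matrix D D ℂ) (c : ℂ) (hc : c ≠ 0)
    (h : ∀ x y z w, ∑ i, P i x y * star (P i z w) = c * if x = z ∧ y = w then 1 else 0)
    (M : Matrix D D ℂ) (hM : ∀ i, M * P i = P i * M) : ∃ r : ℂ, M = r • 1 := by
  have hs : ∀ z w, Matrix.single z w (1:ℂ) = c⁻¹ • ∑ i, star (P i z w) • P i := by
    intro z w
    ext x y
    simp only [Matrix.smul_apply, Matrix.sum_apply, smul_eq_mul]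
    have := h x y z w
    simp only [mul_comm (P _ x y)] at this
    rw [this, ← mul_assoc, inv_mul_cancel₀ hc, one_mul, Matrix.single_apply]
    simp only [eq_comm]
  have : M ∈ Set.range (Matrix.scalar D) := by
    rw [Matrix.mem_range_scalar_iff_commute_single]
    intro i j _
    rw [hs, Commute, SemiconjBy, Matrix.smul_mul, Matrix.mul_smul, Matrix.mul_sum, Matrix.sum_mul]
    simp [hM]
  obtain ⟨r, rfl⟩ := this
  exact ⟨r, by rw [Matrix.scalar_apply, Matrix.smul_one_eq_diagonal]⟩

lemma kron_prop {D E : Type*} {A C : Matrix D D ℂ} {B B' : Matrix E E ℂ}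
    (h : A ⊗ₖ B = C ⊗ₖ B') (hB : B ≠ 0) : ∃ r : ℂ, A = r • C := by
  have : ∃ i j, B i j ≠ 0 := by
    by_contra! hh; exact hB (by ext i j; simp [hh])
  obtain ⟨i, j, hij⟩ := this
  refine ⟨B' i j / B i j, ?_⟩
  ext x y
  have := congrFun (congrFun h (x, i)) (y, j)
  simp only [Matrix.kroneckerMap_apply] at this
  simp only [Matrix.smul_apply, smul_eq_mul]
  field_simp
  linear_combination this

lemma kron_prop' {D E : Type*} {A C : Matrix D D ℂ} {B B' : Matrix E E ℂ}
    (h : A ⊗ₖ B = C ⊗ₖ B') (hA : A ≠ 0) : ∃ r : ℂ, B = r • B' := by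
  have : ∃ i j, A i j ≠ 0 := by
    by_contra! hh; exact hA (by ext i j; simp [hh])
  obtain ⟨i, j, hij⟩ := this
  refine ⟨C i j / A i j, ?_⟩
  ext x y
  have := congrFun (congrFun h (i, x)) (j, y)
  simp only [Matrix.kroneckerMap_apply] at this
  simp only [Matrix.smul_apply, smul_eq_mul]
  field_simp
  linear_combination this

lemma scalar_of_ps {ι : Type*} [Fintype ι] [DecidableEq ι]
    (M : Matrix (ι → Fin 2) (ι → Fin 2) ℂ)
    (hM : ∀ a, M * pauliString a = pauliString a * M) : ∃ r : ℂ, M = r • 1 :=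
  scalar_of_complete pauliString _ (pow_ne_zero _ two_ne_zero) ps_complete M hM

section inter
variable {D : Type*} [Fintype D] [DecidableEq D] {k : ℕ}

lemma inter_raw (F : (Fin k → Fin 4) → Matrix D D ℂ)
    (hmul : ∀ a b, F a * F b = (∏ i, pph (a i) (b i)) • F (fun i => pmul (a i) (b i)))
    (M : Matrix D (Fin k → Fin 2) ℂ) (b : Fin k → Fin 4) :
    F b * (∑ a, F a * M * (pauliString a)ᴴ) = (∑ a, F a * M * (pauliString a)ᴴ) * pauliString b := by
  rw [Matrix.mul_sum, Matrix.sum_mul]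
  refine Fintype.sum_equiv (Function.Involutive.toPerm
    (fun a : Fin k → Fin 4 => fun i => pmul (b i) (a i))
    (fun a => funext fun i => pmul_pmul _ _)) _ _ fun a => ?_
  change F b * (F a * M * (pauliString a)ᴴ) = F (fun i => pmul (b i) (a i)) * M *
    (pauliString (fun i => pmul (b i) (a i)))ᴴ * pauliString b
  have hp := ps_phase b a
  set c := ∏ i, pph (b i) (a i) with hc
  have hF : F (fun i => pmul (b i) (a i)) = star c • (F b * F a) := by
    rw [hmul, smul_smul, hp, one_smul]
  have hP : pauliString (fun i => pmul (b i) (a i)) = star c • (pauliString b * pauliString a) := by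
    rw [ps_mul, smul_smul, hp, one_smul]
  rw [hF, hP, Matrix.conjTranspose_smul, star_star, Matrix.conjTranspose_mul, ps_herm, ps_herm]
  simp only [Matrix.smul_mul, Matrix.mul_smul, smul_smul, Matrix.mul_assoc, ps_sq, Matrix.mul_one]
  rw [mul_comm c, hp, one_smul]

lemma inter_ne (F : (Fin k → Fin 4) → Matrix D D ℂ) (hF : ∃ a, F a ≠ 0) :
    ∃ M : Matrix D (Fin k → Fin 2) ℂ, ∑ a, F a * M * (pauliString a)ᴴ ≠ 0 := by
  by_contra! h
  obtain ⟨a₀, ha⟩ := hF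
  apply ha
  have h1 : ∀ p i q j, ∑ a, F a p i * star (pauliString a q j) = 0 := by
    intro p i q j
    have := congrFun (congrFun (h (Matrix.single i j 1)) p) q
    simp only [Matrix.sum_apply, Matrix.zero_apply] at this
    rw [← this]
    refine Finset.sum_congr rfl fun a _ => ?_
    rw [Matrix.mul_apply, Finset.sum_eq_single j]
    · simp
    · intro b _ hb
      rw [Matrix.mul_single_apply_of_ne]
      · simp
      · exact hb
    · simp
  ext p i
  -- orthogonality of Pauli strings
  have ho : ∀ a, ∑ q, ∑ j, star (pauliString a q j) * pauliString a₀ q j =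
      if a = a₀ then 2 ^ k else 0 := by
    intro a
    have e : ∀ x y, star (pauliString a x y) * pauliString a₀ x y =
      ∏ i, (star (pauli (a i) (x i) (y i)) * pauli (a₀ i) (x i) (y i)) := by
      intro x y; simp [pauliString, star_prod, Finset.prod_mul_distrib]
    simp only [e]
    have : ∀ x : Fin k → Fin 2, ∑ y : Fin k → Fin 2,
        ∏ i, (star (pauli (a i) (x i) (y i)) * pauli (a₀ i) (x i) (y i))
        = ∏ i, ∑ w, (star (pauli (a i) (x i) w) * pauli (a₀ i) (x i) w) := by
      intro x
      rw [Fintype.prod_sum (fun i w => (star (pauli (a i) (x i) w) * pauli (a₀ i) (x i) w))]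
    simp only [this]
    rw [← Fintype.prod_sum (fun i z => ∑ w, (star (pauli (a i) z w) * pauli (a₀ i) z w))]
    have s : ∀ i j : Fin 4, ∑ z, ∑ w, (star (pauli i z w) * pauli j z w) =
        2 * if i = j then 1 else 0 := by
      intro i j
      fin_cases i <;> fin_cases j <;> norm_num [pauli, Fin.sum_univ_two]
    simp only [s, Finset.prod_mul_distrib, Finset.prod_const, Finset.card_univ, Fintype.card_fin]
    rw [Finset.prod_ite_zero]
    simp [funext_iff]
  have h2 : ∑ q, ∑ j, (∑ a, F a p i * star (pauliString a q j)) * pauliString a₀ q j = 0 := by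
    simp only [h1, zero_mul, Finset.sum_const_zero]
  have h3 : ∑ q, ∑ j, (∑ a, F a p i * star (pauliString a q j)) * pauliString a₀ q j
      = ∑ a, F a p i * if a = a₀ then 2 ^ k else 0 := by
    simp only [← ho, Finset.mul_sum, Finset.sum_mul]
    rw [Finset.sum_comm' (t' := Finset.univ) (s' := fun _ => Finset.univ) (by simp)]
    conv_rhs => rw [Finset.sum_comm]
    rw [Finset.sum_comm]
    refine Finset.sum_congr rfl fun q _ => ?_
    rw [Finset.sum_comm]
    refine Finset.sum_congr rfl fun a _ => ?_
    refine Finset.sum_congr rfl fun j _ => by ring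
  rw [h2] at h3
  simpa using h3.symm

lemma intertwiner [Nonempty D] (F : (Fin k → Fin 4) → Matrix D D ℂ)
    (hh : ∀ a, (F a)ᴴ = F a) (hsq : ∀ a, F a * F a = 1)
    (hmul : ∀ a b, F a * F b = (∏ i, pph (a i) (b i)) • F (fun i => pmul (a i) (b i))) :
    ∃ T : Matrix D (Fin k → Fin 2) ℂ, Tᴴ * T = 1 ∧ ∀ b, F b * T = T * pauliString b := by
  obtain ⟨M, hM⟩ := inter_ne F ⟨fun _ => 0, fun h => by
    have := hsq fun _ => 0
    rw [h] at this; simp at this⟩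
  have hT := inter_raw F hmul M
  set T := ∑ a, F a * M * (pauliString a)ᴴ
  have hT' : ∀ b, Tᴴ * F b = pauliString b * Tᴴ := fun b => by
    have := congrArg Matrix.conjTranspose (hT b)
    simpa [Matrix.conjTranspose_mul, hh, ps_herm] using this
  obtain ⟨r, hr⟩ := scalar_of_ps (Tᴴ * T) (fun b => by
    rw [Matrix.mul_assoc, ← hT, ← Matrix.mul_assoc, hT', Matrix.mul_assoc])
  have hr0 : r ≠ 0 := by
    rintro rfl
    rw [zero_smul] at hr
    open scoped ComplexOrder in rw [Matrix.conjTranspose_mul_self_eq_zero] at hr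
    exact hM hr
  have hrr : r = ((∑ p, ‖T p 0‖ ^ 2 : ℝ) : ℂ) := by
    have := congrFun (congrFun hr 0) 0
    simp only [Matrix.mul_apply, Matrix.smul_apply, Matrix.one_apply_eq, smul_eq_mul, mul_one,
      Matrix.conjTranspose_apply] at this
    rw [← this]
    push_cast
    refine Finset.sum_congr rfl fun p _ => ?_
    simpa using Complex.conj_mul' (T p 0)
  set ρ : ℝ := ∑ p, ‖T p 0‖ ^ 2 with hρ
  have hρ0 : 0 < ρ := lt_of_le_of_ne (Finset.sum_nonneg fun _ _ => by positivity)
    (fun h => hr0 (by rw [hrr, ← h]; simp))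
  refine ⟨((Real.sqrt ρ : ℝ) : ℂ)⁻¹ • T, ?_, fun b => ?_⟩
  · rw [Matrix.conjTranspose_smul, Matrix.smul_mul, Matrix.mul_smul, hr, smul_smul, smul_smul, hrr]
    have : star ((Real.sqrt ρ : ℝ) : ℂ)⁻¹ * (((Real.sqrt ρ : ℝ) : ℂ)⁻¹ * (ρ:ℂ)) = 1 := by
      have h1 : (ρ:ℂ) = (Real.sqrt ρ : ℂ) * (Real.sqrt ρ : ℂ) := by
        rw [← Complex.ofReal_mul, Real.mul_self_sqrt hρ0.le]
      have h2 : (Real.sqrt ρ : ℂ) ≠ 0 := by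
        exact_mod_cast (Real.sqrt_pos.2 hρ0).ne'
      have h3 : star ((Real.sqrt ρ : ℝ) : ℂ)⁻¹ = ((Real.sqrt ρ : ℝ) : ℂ)⁻¹ := by
        rw [star_inv₀]; simp
      rw [h3]
      calc _ = ((Real.sqrt ρ : ℝ) : ℂ)⁻¹ * (((Real.sqrt ρ : ℝ) : ℂ)⁻¹ *
            ((Real.sqrt ρ : ℂ) * (Real.sqrt ρ : ℂ))) := by rw [← h1]
        _ = 1 := by field_simp
    rw [mul_assoc, this, one_smul]
  · rw [Matrix.mul_smul, Matrix.smul_mul, hT]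

lemma card_le_of_iso {E : Type*} [Fintype E] [DecidableEq E] (T : Matrix D E ℂ) (h : Tᴴ * T = 1) :
    Fintype.card E ≤ Fintype.card D := by
  have h1 := Matrix.rank_mul_le_right Tᴴ T
  rw [h, Matrix.rank_one] at h1
  exact h1.trans (Matrix.rank_le_card_height T)

end inter

section good
variable {D : Type*} [Fintype D] [DecidableEq D]

structure GoodSet (S : Set (Matrix D D ℂ)) : Prop where
  herm : ∀ s ∈ S, sᴴ = s
  sq : ∀ s ∈ S, s * s = 1
  one : (1 : Matrix D D ℂ) ∈ S
  comm : ∀ s ∈ S, ∀ t ∈ S, s * t = t * s ∨ s * t = -(t * s)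
  mulc : ∀ s ∈ S, ∀ t ∈ S, s * t = t * s → s * t ∈ S
  mula : ∀ s ∈ S, ∀ t ∈ S, s * t = -(t * s) → Complex.I • (s * t) ∈ S
  cent : ∀ M : Matrix D D ℂ, (∀ s ∈ S, M * s = s * M) → ∃ r : ℂ, M = r • 1

structure Fam (S : Set (Matrix D D ℂ)) (k : ℕ) (F : (Fin k → Fin 4) → Matrix D D ℂ) : Prop where
  mem : ∀ a, F a ∈ S
  mul : ∀ a b, F a * F b = (∏ i, pph (a i) (b i)) • F (fun i => pmul (a i) (b i))
  cover : ∀ s ∈ S, ∃ a, ∀ b, Commute (F a * s) (F b)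

lemma GoodSet.phase {S : Set (Matrix D D ℂ)} (h : GoodSet S) {s t : Matrix D D ℂ}
    (hs : s ∈ S) (ht : t ∈ S) : ∃ c : ℂ, c ≠ 0 ∧ c • (s * t) ∈ S := by
  rcases h.comm s hs t ht with hc | hc
  · exact ⟨1, one_ne_zero, by rw [one_smul]; exact h.mulc s hs t ht hc⟩
  · exact ⟨Complex.I, Complex.I_ne_zero, h.mula s hs t ht hc⟩

noncomputable def tau (A B : Matrix D D ℂ) : Fin 4 → Matrix D D ℂ :=
  ![1, A, Complex.I • (A * B), B]

lemma tau_mul {A B : Matrix D D ℂ} (hA : A * A = 1) (hB : B * B = 1) (hBA : B * A = -(A * B))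
    (i j : Fin 4) : tau A B i * tau A B j = pph i j • tau A B (pmul i j) := by
  have hA' : ∀ x, A * (A * x) = x := fun x => by rw [← mul_assoc, hA, one_mul]
  have hB' : ∀ x, B * (B * x) = x := fun x => by rw [← mul_assoc, hB, one_mul]
  have hBA' : ∀ x, B * (A * x) = -(A * (B * x)) := fun x => by
    rw [← mul_assoc, hBA, neg_mul, mul_assoc]
  fin_cases i <;> fin_cases j <;>
    simp [tau, pph, pmul, mul_assoc, hA, hB, hBA, hA', hB', hBA', smul_smul]

lemma tau_comm {A B u : Matrix D D ℂ} (hA : Commute u A) (hB : Commute u B) (j : Fin 4) :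
    Commute u (tau A B j) := by
  fin_cases j
  · exact Commute.one_right u
  · exact hA
  · exact (hA.mul_right hB).smul_right _
  · exact hB

lemma tau_cover {A B u : Matrix D D ℂ} (hA : A * A = 1) (hB : B * B = 1) (hBA : B * A = -(A * B))
    (huA : u * A = A * u ∨ u * A = -(A * u)) (huB : u * B = B * u ∨ u * B = -(B * u)) :
    ∃ j, Commute (tau A B j * u) A ∧ Commute (tau A B j * u) B := by
  have hA' : ∀ x, A * (A * x) = x := fun x => by rw [← mul_assoc, hA, one_mul]
  have hB' : ∀ x, B * (B * x) = x := fun x => by rw [← mul_assoc, hB, one_mul]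
  have hBA' : ∀ x, B * (A * x) = -(A * (B * x)) := fun x => by
    rw [← mul_assoc, hBA, neg_mul, mul_assoc]
  rcases huA with h1 | h1 <;> rcases huB with h2 | h2
  · refine ⟨0, ?_, ?_⟩ <;> simp [Commute, SemiconjBy, tau, h1, h2]
  · refine ⟨1, ?_, ?_⟩ <;> simp [Commute, SemiconjBy, tau, mul_assoc, h1, h2, hBA']
  · refine ⟨3, ?_, ?_⟩ <;> simp [Commute, SemiconjBy, tau, mul_assoc, h1, h2, hBA', hBA]
  · refine ⟨2, ?_, ?_⟩ <;> simp [Commute, SemiconjBy, tau, mul_assoc, h1, h2, hBA', hBA]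

lemma fam_zero {S : Set (Matrix D D ℂ)} (h : GoodSet S) : Fam S 0 (fun _ => 1) :=
  ⟨fun _ => h.one, fun a b => by simp, fun s _ => ⟨Fin.elim0, fun b => Commute.one_right _⟩⟩

lemma fam_step {S : Set (Matrix D D ℂ)} (h : GoodSet S) {k : ℕ} {F : (Fin k → Fin 4) → Matrix D D ℂ}
    (hF : Fam S k F) : (∃ F', Fam S (k + 1) F') ∨
      ∀ s ∈ S, (∀ b, Commute s (F b)) → ∃ r : ℂ, s = r • 1 := by
  by_cases hs : ∀ s ∈ S, (∀ b, Commute s (F b)) → ∃ r : ℂ, s = r • 1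
  · exact Or.inr hs
  left
  push Not at hs
  obtain ⟨A, hAS, hAF, hA⟩ := hs
  have : ∃ s ∈ S, ¬ Commute A s := by
    by_contra! hc
    obtain ⟨r, hr⟩ := h.cent A hc
    exact hA r hr
  obtain ⟨s, hsS, hAs⟩ := this
  obtain ⟨a, ha⟩ := hF.cover s hsS
  obtain ⟨c, hc0, hcS⟩ := h.phase (hF.mem a) hsS
  set B := c • (F a * s) with hBdef
  have hBF : ∀ b, Commute B (F b) := fun b => (ha b).smul_left c
  have hAB : ¬ Commute A B := by
    intro hcomm
    apply hAs
    have h1 : Commute A (F a * s) := by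
      have := hcomm.smul_right c⁻¹
      rwa [hBdef, smul_smul, inv_mul_cancel₀ hc0, one_smul] at this
    have h2 := (hAF a).mul_right h1
    rwa [← mul_assoc, h.sq _ (hF.mem a), one_mul] at h2
  have hBA : B * A = -(A * B) := (h.comm B hcS A hAS).resolve_left fun e => hAB e.symm
  have hAB' : A * B = -(B * A) := by rw [hBA, neg_neg]
  have hτ : ∀ j, tau A B j ∈ S := by
    intro j
    fin_cases j
    · exact h.one
    · exact hAS
    · exact h.mula A hAS B hcS hAB'
    · exact hcS
  have hτF : ∀ j b, Commute (tau A B j) (F b) := fun j b =>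
    (tau_comm (hAF b).symm (hBF b).symm j).symm
  refine ⟨fun a => tau A B (a 0) * F (fun i => a i.succ), ?_, ?_, ?_⟩
  · intro a
    exact h.mulc _ (hτ _) _ (hF.mem _) (hτF _ _)
  · intro a b
    rw [Fin.prod_univ_succ]
    calc _ = tau A B (a 0) * (F (fun i => a i.succ) * tau A B (b 0)) * F (fun i => b i.succ) := by
          simp only [mul_assoc]
      _ = (tau A B (a 0) * tau A B (b 0)) * (F (fun i => a i.succ) * F (fun i => b i.succ)) := by
          rw [← (hτF _ _).eq]; simp only [mul_assoc]
      _ = _ := by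
          rw [tau_mul (h.sq _ hAS) (h.sq _ hcS) hBA, hF.mul, smul_mul_smul_comm]
  · intro t htS
    obtain ⟨a, ha⟩ := hF.cover t htS
    obtain ⟨d, hd0, hdS⟩ := h.phase (hF.mem a) htS
    obtain ⟨j, hjA, hjB⟩ := tau_cover (h.sq _ hAS) (h.sq _ hcS) hBA
      (h.comm _ hdS A hAS) (h.comm _ hdS B hcS)
    have un : ∀ x, Commute (tau A B j * (d • (F a * t))) x → Commute (tau A B j * (F a * t)) x := by
      intro x hx
      have := hx.smul_left d⁻¹
      rwa [Matrix.mul_smul, smul_smul, inv_mul_cancel₀ hd0, one_smul] at this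
    refine ⟨Fin.cons j a, fun b => ?_⟩
    simp only [Fin.cons_zero, Fin.cons_succ, mul_assoc]
    refine (tau_comm (un _ hjA) (un _ hjB) _).mul_right ?_
    exact (hτF _ _).mul_left (ha _)

lemma good_main [Nonempty D] {S : Set (Matrix D D ℂ)} (h : GoodSet S) :
    ∃ (k : ℕ) (T : Matrix D (Fin k → Fin 2) ℂ), Tᴴ * T = 1 ∧ T * Tᴴ = 1 ∧
      ∀ s ∈ S, ∃ (a : Fin k → Fin 4) (c : ℂ), s = c • (T * pauliString a * Tᴴ) := by
  have key : ∃ (k : ℕ) (F : (Fin k → Fin 4) → Matrix D D ℂ), Fam S k F ∧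
      ∀ s ∈ S, (∀ b, Commute s (F b)) → ∃ r : ℂ, s = r • 1 := by
    by_contra! hno
    have all : ∀ k, ∃ F, Fam S k F := by
      intro k
      induction k with
      | zero => exact ⟨_, fam_zero h⟩
      | succ k ih =>
        obtain ⟨F, hF⟩ := ih
        rcases fam_step h hF with h1 | h1
        · exact h1
        · obtain ⟨s, hs, hb, hr⟩ := hno k F hF
          obtain ⟨r, hr'⟩ := h1 s hs hb
          exact absurd hr' (hr r)
    obtain ⟨F, hF⟩ := all (Fintype.card D)
    obtain ⟨T, hT, -⟩ := intertwiner F (fun a => h.herm _ (hF.mem a)) (fun a => h.sq _ (hF.mem a))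
      hF.mul
    have := card_le_of_iso T hT
    simp only [Fintype.card_pi, Fintype.card_fin, Finset.prod_const, Finset.card_univ] at this
    exact absurd this (not_le.2 (Nat.lt_two_pow_self))
  obtain ⟨k, F, hF, hsc⟩ := key
  obtain ⟨T, hT, hTF⟩ := intertwiner F (fun a => h.herm _ (hF.mem a)) (fun a => h.sq _ (hF.mem a))
      hF.mul
  have hT' : ∀ b, Tᴴ * F b = pauliString b * Tᴴ := fun b => by
    have := congrArg Matrix.conjTranspose (hTF b)
    simpa [Matrix.conjTranspose_mul, h.herm _ (hF.mem b), ps_herm] using this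
  have hS : ∀ s ∈ S, ∃ (a : Fin k → Fin 4) (c : ℂ), s = c • F a := by
    intro s hs
    obtain ⟨a, ha⟩ := hF.cover s hs
    obtain ⟨c, hc0, hcS⟩ := h.phase (hF.mem a) hs
    obtain ⟨r, hr⟩ := hsc _ hcS (fun b => (ha b).smul_left c)
    refine ⟨a, c⁻¹ * r, ?_⟩
    have : F a * s = (c⁻¹ * r) • 1 := by
      rw [mul_smul, ← hr, smul_smul, inv_mul_cancel₀ hc0, one_smul]
    calc s = F a * (F a * s) := by rw [← mul_assoc, h.sq _ (hF.mem a), one_mul]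
      _ = _ := by rw [this, Matrix.mul_smul, mul_one]
  obtain ⟨r, hr⟩ := h.cent (T * Tᴴ) (fun s hs => by
    obtain ⟨a, c, rfl⟩ := hS s hs
    rw [Matrix.mul_smul, Matrix.smul_mul, Matrix.mul_assoc, hT', ← Matrix.mul_assoc,
      ← Matrix.mul_assoc, hTF])
  have hTT : T * Tᴴ = 1 := by
    have e : r • T = T := by
      calc r • T = (r • (1 : Matrix D D ℂ)) * T := by rw [Matrix.smul_mul, Matrix.one_mul]
        _ = T := by rw [← hr, Matrix.mul_assoc, hT, Matrix.mul_one]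
    have e2 : r • (1 : Matrix (Fin k → Fin 2) (Fin k → Fin 2) ℂ) = 1 := by
      rw [← hT, ← Matrix.mul_smul, e]
    have e3 := congrFun (congrFun e2 0) 0
    simp at e3
    rw [hr, e3, one_smul]
  refine ⟨k, T, hT, hTT, fun s hs => ?_⟩
  obtain ⟨a, c, rfl⟩ := hS s hs
  refine ⟨a, c, ?_⟩
  rw [← hTF, Matrix.mul_assoc, hTT, Matrix.mul_one]

lemma good_fin {n : ℕ} {S : Set (Matrix (Fin n → Fin 2) (Fin n → Fin 2) ℂ)} (h : GoodSet S) :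
    ∃ V ∈ Matrix.unitaryGroup (Fin n → Fin 2) ℂ,
      ∀ s ∈ S, ∃ (a : Fin n → Fin 4) (c : ℂ), s = c • (V * pauliString a * Vᴴ) := by
  obtain ⟨k, T, h1, h2, h3⟩ := good_main h
  have a1 := card_le_of_iso T h1
  have a2 := card_le_of_iso Tᴴ (by rwa [Matrix.conjTranspose_conjTranspose])
  simp only [Fintype.card_pi, Fintype.card_fin, Finset.prod_const, Finset.card_univ] at a1 a2
  have : k = n := Nat.pow_right_injective le_rfl (le_antisymm a1 a2)
  subst this
  exact ⟨T, Matrix.mem_unitaryGroup_iff.2 h2, h3⟩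

end good

section side
variable {D E I : Type*} [Fintype D] [DecidableEq D] [Fintype E] [DecidableEq E]

structure GoodFam (Q : I → Matrix (D × E) (D × E) ℂ) : Prop where
  herm : ∀ i, (Q i)ᴴ = Q i
  sq : ∀ i, Q i * Q i = 1
  one : ∃ i, Q i = 1
  comm : ∀ i j, Q i * Q j = Q j * Q i ∨ Q i * Q j = -(Q j * Q i)
  mul : ∀ i j, ∃ (k : I) (c : ℂ), c ≠ 0 ∧ Q i * Q j = c • Q k
  cent : ∀ M : Matrix (D × E) (D × E) ℂ, (∀ i, M * Q i = Q i * M) → ∃ r : ℂ, M = r • 1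
  prod : ∀ i, ∃ (X : Matrix D D ℂ) (Y : Matrix E E ℂ), Q i = X ⊗ₖ Y

lemma sign_of_smul {D : Type*} [Fintype D] [DecidableEq D] [Nonempty D] {s t : Matrix D D ℂ} {μ : ℂ}
    (hs : s * s = 1) (ht : t * t = 1) (h : s = μ • t) : μ = 1 ∨ μ = -1 := by
  have e : (μ * μ) • (1 : Matrix D D ℂ) = 1 := by
    rw [h, smul_mul_smul_comm, ht] at hs; exact hs
  obtain ⟨x⟩ := ‹Nonempty D›
  have := congrFun (congrFun e x) x
  simp at this
  exact mul_self_eq_one_iff.1 this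

lemma side_exists [Nonempty D] [Nonempty E] {Q : I → Matrix (D × E) (D × E) ℂ} (hQ : GoodFam Q) :
    ∃ S : Set (Matrix D D ℂ), GoodSet S ∧ ∀ i, ∃ s ∈ S, ∃ Y, Q i = s ⊗ₖ Y := by
  have nz : ∀ i j, Q i * Q j ≠ 0 := by
    intro i j h
    have : Q i * (Q i * Q j) * Q j = 1 := by
      rw [← mul_assoc, hQ.sq, one_mul, hQ.sq]
    rw [h] at this
    simp at this
  have norm : ∀ i, ∃ s : Matrix D D ℂ, (sᴴ = s ∧ s * s = 1) ∧ ∃ Y, Q i = s ⊗ₖ Y := by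
    intro i
    obtain ⟨X, Y, h⟩ := hQ.prod i
    have h1 : (X * X) ⊗ₖ (Y * Y) = (1 : Matrix D D ℂ) ⊗ₖ (1 : Matrix E E ℂ) := by
      rw [Matrix.mul_kronecker_mul, ← h, hQ.sq, Matrix.one_kronecker_one]
    have hY : Y * Y ≠ 0 := by
      intro h0
      rw [h0, Matrix.kronecker_zero, Matrix.one_kronecker_one] at h1
      exact zero_ne_one h1
    have hX : X * X ≠ 0 := by
      intro h0
      rw [h0, Matrix.zero_kronecker, Matrix.one_kronecker_one] at h1
      exact zero_ne_one h1
    obtain ⟨μ, hμ⟩ := kron_prop h1 hY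
    have hμ0 : μ ≠ 0 := by
      rintro rfl
      rw [zero_smul] at hμ; exact hX hμ
    obtain ⟨ν, hν⟩ := IsAlgClosed.exists_pow_nat_eq μ (n := 2) (by norm_num)
    have hν0 : ν ≠ 0 := by
      rintro rfl
      exact hμ0 (by rw [← hν]; simp)
    have hsq : (ν⁻¹ • X) * (ν⁻¹ • X) = 1 := by
      rw [smul_mul_smul_comm, hμ, smul_smul, ← hν]
      have : ν⁻¹ * ν⁻¹ * ν ^ 2 = 1 := by field_simp
      rw [this, one_smul]
    have hk : Q i = (ν⁻¹ • X) ⊗ₖ (ν • Y) := by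
      rw [h, Matrix.smul_kronecker, Matrix.kronecker_smul, smul_smul, inv_mul_cancel₀ hν0, one_smul]
    refine ⟨ν⁻¹ • X, ⟨?_, hsq⟩, ν • Y, hk⟩
    set s := ν⁻¹ • X
    have h2 : sᴴ ⊗ₖ (ν • Y)ᴴ = s ⊗ₖ (ν • Y) := by
      rw [← Matrix.conjTranspose_kronecker, ← hk, hQ.herm]
    have hY' : (ν • Y)ᴴ ≠ 0 := by
      intro h0
      rw [Matrix.conjTranspose_eq_zero] at h0
      rw [h0, Matrix.kronecker_zero] at hk
      have := nz i i
      rw [hk] at this; simp at this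
    obtain ⟨l, hl⟩ := kron_prop h2 hY'
    have hsq' : sᴴ * sᴴ = 1 := by
      rw [← Matrix.conjTranspose_mul, hsq, Matrix.conjTranspose_one]
    rcases sign_of_smul hsq' hsq hl with rfl | rfl
    · rw [hl, one_smul]
    · exfalso
      have e : sᴴ * s = -1 := by rw [hl, Matrix.smul_mul, hsq, neg_one_smul]
      obtain ⟨x⟩ := ‹Nonempty D›
      have := congrFun (congrFun e x) x
      rw [Matrix.mul_apply] at this
      have h3 : ((∑ p, ‖s p x‖ ^ 2 : ℝ) : ℂ) = ((-1 : ℝ) : ℂ) := by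
        simp only [Matrix.neg_apply, Matrix.one_apply_eq] at this
        push_cast
        rw [← this]
        refine Finset.sum_congr rfl fun p _ => ?_
        simpa using (Complex.conj_mul' (s p x)).symm
      have h4 := Complex.ofReal_injective h3
      have h5 : 0 ≤ ∑ p, ‖s p x‖ ^ 2 := Finset.sum_nonneg fun _ _ => by positivity
      linarith
  refine ⟨{s | (sᴴ = s ∧ s * s = 1) ∧ ∃ i Y, Q i = s ⊗ₖ Y}, ⟨?_, ?_, ?_, ?_, ?_, ?_, ?_⟩, ?_⟩
  · rintro s ⟨⟨h, -⟩, -⟩; exact h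
  · rintro s ⟨⟨-, h⟩, -⟩; exact h
  · obtain ⟨i, hi⟩ := hQ.one
    exact ⟨⟨by simp, by simp⟩, i, 1, by rw [hi, Matrix.one_kronecker_one]⟩
  · rintro s ⟨⟨-, hs⟩, i, Y, hi⟩ t ⟨⟨-, ht⟩, j, Z, hj⟩
    have hne : Y * Z ≠ 0 := by
      intro h0
      apply nz i j
      rw [hi, hj, ← Matrix.mul_kronecker_mul, h0, Matrix.kronecker_zero]
    have : ∃ W : Matrix E E ℂ, (s * t) ⊗ₖ (Y * Z) = (t * s) ⊗ₖ W := by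
      rcases hQ.comm i j with h | h
      · refine ⟨Z * Y, ?_⟩
        rw [Matrix.mul_kronecker_mul, Matrix.mul_kronecker_mul, ← hi, ← hj, h]
      · refine ⟨(-1 : ℂ) • (Z * Y), ?_⟩
        rw [Matrix.kronecker_smul, Matrix.mul_kronecker_mul, Matrix.mul_kronecker_mul, ← hi, ← hj, h,
          neg_one_smul]
    obtain ⟨W, hW⟩ := this
    obtain ⟨μ, hμ⟩ := kron_prop hW hne
    have e : s * t * s = μ • t := by
      rw [hμ, Matrix.smul_mul, mul_assoc, hs, mul_one]
    have e2 : (s * t * s) * (s * t * s) = 1 := by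
      calc _ = s * (t * (s * s) * t) * s := by simp only [mul_assoc]
        _ = 1 := by rw [hs, mul_one, ht, mul_one, hs]
    rcases sign_of_smul e2 ht e with rfl | rfl
    · left; rw [hμ, one_smul]
    · right; rw [hμ, neg_one_smul]
  · rintro s ⟨⟨hs', hs⟩, i, Y, hi⟩ t ⟨⟨ht', ht⟩, j, Z, hj⟩ hc
    refine ⟨⟨?_, ?_⟩, ?_⟩
    · rw [Matrix.conjTranspose_mul, hs', ht', hc]
    · calc s * t * (s * t) = s * t * (t * s) := by rw [hc]
        _ = s * (t * t) * s := by simp only [mul_assoc]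
        _ = 1 := by rw [ht, mul_one, hs]
    · obtain ⟨k, c, hc0, hk⟩ := hQ.mul i j
      refine ⟨k, c⁻¹ • (Y * Z), ?_⟩
      rw [Matrix.kronecker_smul, Matrix.mul_kronecker_mul, ← hi, ← hj, hk, smul_smul,
        inv_mul_cancel₀ hc0, one_smul]
  · rintro s ⟨⟨hs', hs⟩, i, Y, hi⟩ t ⟨⟨ht', ht⟩, j, Z, hj⟩ hc
    refine ⟨⟨?_, ?_⟩, ?_⟩
    · rw [Matrix.conjTranspose_smul, Matrix.conjTranspose_mul, hs', ht', hc]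
      simp
    · have : s * t * (s * t) = -1 := by
        calc s * t * (s * t) = s * t * (-(t * s)) := by rw [← hc]
          _ = -(s * (t * t) * s) := by simp only [mul_assoc, mul_neg]
          _ = -1 := by rw [ht, mul_one, hs]
      rw [smul_mul_smul_comm, this, Complex.I_mul_I, neg_one_smul, neg_neg]
    · obtain ⟨k, c, hc0, hk⟩ := hQ.mul i j
      refine ⟨k, (Complex.I⁻¹ * c⁻¹) • (Y * Z), ?_⟩
      rw [Matrix.smul_kronecker, Matrix.kronecker_smul, Matrix.mul_kronecker_mul, ← hi, ← hj, hk,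
        smul_smul, smul_smul]
      have : Complex.I * (Complex.I⁻¹ * c⁻¹) * c = 1 := by
        have := Complex.I_ne_zero
        field_simp
      rw [this, one_smul]
  · intro M hM
    obtain ⟨r, hr⟩ := hQ.cent (M ⊗ₖ 1) (fun i => by
      obtain ⟨s, hs, Y, hY⟩ := norm i
      rw [hY, ← Matrix.mul_kronecker_mul, ← Matrix.mul_kronecker_mul, hM s ⟨hs, i, Y, hY⟩, one_mul,
        mul_one])
    rw [← Matrix.one_kronecker_one] at hr
    have : M ⊗ₖ (1 : Matrix E E ℂ) = 1 ⊗ₖ (r • (1 : Matrix E E ℂ)) := by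
      rw [hr, Matrix.kronecker_smul]
    exact kron_prop this one_ne_zero
  · intro i
    obtain ⟨s, hs, Y, hY⟩ := norm i
    exact ⟨s, ⟨hs, i, Y, hY⟩, Y, hY⟩

lemma GoodFam.swap {Q : I → Matrix (D × E) (D × E) ℂ} (hQ : GoodFam Q) :
    GoodFam (fun i => (Q i).submatrix (Equiv.prodComm E D) (Equiv.prodComm E D)) := by
  refine ⟨fun i => ?_, fun i => ?_, ?_, fun i j => ?_, fun i j => ?_, fun M hM => ?_, fun i => ?_⟩
  · rw [Matrix.conjTranspose_submatrix, hQ.herm]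
  · rw [Matrix.submatrix_mul_equiv, hQ.sq, Matrix.submatrix_one_equiv]
  · obtain ⟨i, hi⟩ := hQ.one
    exact ⟨i, by rw [hi, Matrix.submatrix_one_equiv]⟩
  · simp only [Matrix.submatrix_mul_equiv]
    rcases hQ.comm i j with h | h
    · left; rw [h]
    · right; rw [h]; rfl
  · obtain ⟨k, c, hc, h⟩ := hQ.mul i j
    refine ⟨k, c, hc, ?_⟩
    rw [Matrix.submatrix_mul_equiv, h]; rfl
  · obtain ⟨r, hr⟩ := hQ.cent (M.submatrix (Equiv.prodComm D E) (Equiv.prodComm D E)) (fun i => by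
      have := congrArg (fun A => A.submatrix (Equiv.prodComm D E) (Equiv.prodComm D E)) (hM i)
      simp only [← Matrix.submatrix_mul_equiv _ _ _ (Equiv.prodComm D E)] at this
      exact this)
    refine ⟨r, ?_⟩
    have := congrArg (fun A => A.submatrix (Equiv.prodComm E D) (Equiv.prodComm E D)) hr
    have h2 : (r • (1 : Matrix (D × E) (D × E) ℂ)).submatrix (Equiv.prodComm E D)
        (Equiv.prodComm E D) = r • 1 := by
      rw [Matrix.submatrix_smul, Pi.smul_apply, Pi.smul_apply, Matrix.submatrix_one_equiv]
    rw [← h2]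
    exact this
  · obtain ⟨X, Y, h⟩ := hQ.prod i
    refine ⟨Y, X, ?_⟩
    rw [h]
    ext x y
    simp [mul_comm]

end side

lemma pauliP_goodFam {NA NB : ℕ}
    (U : Matrix ((Fin NA → Fin 2) × (Fin NB → Fin 2))
      ((Fin NA → Fin 2) × (Fin NB → Fin 2)) ℂ)
    (hU : U ∈ Matrix.unitaryGroup ((Fin NA → Fin 2) × (Fin NB → Fin 2)) ℂ)
    (hprod : ∀ (a : Fin NA → Fin 4) (b : Fin NB → Fin 4),
      ∃ (X : Matrix (Fin NA → Fin 2) (Fin NA → Fin 2) ℂ)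
        (Y : Matrix (Fin NB → Fin 2) (Fin NB → Fin 2) ℂ),
        Uᴴ * pauliP a b * U = X ⊗ₖ Y) :
    GoodFam (fun p : (Fin NA → Fin 4) × (Fin NB → Fin 4) => Uᴴ * pauliP p.1 p.2 * U) := by
  have h1 : Uᴴ * U = 1 := Matrix.mem_unitaryGroup_iff'.1 hU
  have h2 : U * Uᴴ = 1 := Matrix.mem_unitaryGroup_iff.1 hU
  have cm : ∀ A B, (Uᴴ * A * U) * (Uᴴ * B * U) = Uᴴ * (A * B) * U := by
    intro A B
    calc _ = Uᴴ * A * (U * Uᴴ) * B * U := by simp only [mul_assoc]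
      _ = _ := by rw [h2, mul_one]; simp only [mul_assoc]
  refine ⟨fun i => ?_, fun i => ?_, ?_, fun i j => ?_, fun i j => ?_, fun M hM => ?_,
    fun i => hprod i.1 i.2⟩
  · rw [Matrix.conjTranspose_mul, Matrix.conjTranspose_mul, Matrix.conjTranspose_conjTranspose,
      pauliP, Matrix.conjTranspose_kronecker, ps_herm, ps_herm, mul_assoc]
  · rw [cm, pauliP, ← Matrix.mul_kronecker_mul, ps_sq, ps_sq, Matrix.one_kronecker_one, mul_one, h1]
  · refine ⟨(fun _ => 0, fun _ => 0), ?_⟩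
    simp only [pauliP, ps_zero, Matrix.one_kronecker_one, mul_one, h1]
  · simp only [cm, pauliP, ← Matrix.mul_kronecker_mul]
    have e1 : ∀ (X : Matrix (Fin NA → Fin 2) (Fin NA → Fin 2) ℂ)
      (Y : Matrix (Fin NB → Fin 2) (Fin NB → Fin 2) ℂ), (-X) ⊗ₖ Y = - (X ⊗ₖ Y) := by
      intro X Y; ext x y; simp
    have e2 : ∀ (X : Matrix (Fin NA → Fin 2) (Fin NA → Fin 2) ℂ)
      (Y : Matrix (Fin NB → Fin 2) (Fin NB → Fin 2) ℂ), X ⊗ₖ (-Y) = - (X ⊗ₖ Y) := by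
      intro X Y; ext x y; simp
    rcases ps_comm i.1 j.1 with h | h <;> rcases ps_comm i.2 j.2 with h' | h' <;> rw [h, h'] <;>
      simp [e1, e2]
  · refine ⟨(fun x => pmul (i.1 x) (j.1 x), fun x => pmul (i.2 x) (j.2 x)),
      (∏ x, pph (i.1 x) (j.1 x)) * (∏ x, pph (i.2 x) (j.2 x)), ?_, ?_⟩
    · exact mul_ne_zero (right_ne_zero_of_mul_eq_one (ps_phase _ _))
        (right_ne_zero_of_mul_eq_one (ps_phase _ _))
    · simp only [cm, pauliP, ← Matrix.mul_kronecker_mul, ps_mul, Matrix.smul_kronecker,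
        Matrix.kronecker_smul, Matrix.mul_smul, Matrix.smul_mul, smul_smul]
      rw [mul_comm]
  · obtain ⟨r, hr⟩ := scalar_of_complete
      (fun p : (Fin NA → Fin 4) × (Fin NB → Fin 4) => pauliP p.1 p.2)
      (2 ^ Fintype.card (Fin NA) * 2 ^ Fintype.card (Fin NB))
      (mul_ne_zero (pow_ne_zero _ two_ne_zero) (pow_ne_zero _ two_ne_zero))
      (by
        intro x y z w
        have e : ∀ p : (Fin NA → Fin 4) × (Fin NB → Fin 4),
          pauliP p.1 p.2 x y * star (pauliP p.1 p.2 z w) =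
          (pauliString p.1 x.1 y.1 * star (pauliString p.1 z.1 w.1)) *
          (pauliString p.2 x.2 y.2 * star (pauliString p.2 z.2 w.2)) := by
          intro p
          simp only [pauliP, Matrix.kroneckerMap_apply, star_mul']
          ring
        simp only [e]
        rw [Fintype.sum_prod_type]
        dsimp only
        rw [← Finset.sum_mul_sum, ps_complete, ps_complete,
          mul_mul_mul_comm]
        congr 1
        rw [ite_zero_mul_ite_zero, mul_one]
        simp only [Prod.ext_iff]
        exact if_congr (by tauto) rfl rfl)
      (U * M * Uᴴ) (fun p => by
        have := hM p
        calc U * M * Uᴴ * pauliP p.1 p.2 = U * (M * (Uᴴ * pauliP p.1 p.2 * U)) * Uᴴ := by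
              simp only [mul_assoc, h2, mul_one]
          _ = (U * Uᴴ) * pauliP p.1 p.2 * (U * M * Uᴴ) := by rw [this]; simp only [mul_assoc]
          _ = _ := by rw [h2, one_mul])
    refine ⟨r, ?_⟩
    calc M = (Uᴴ * U) * M * (Uᴴ * U) := by rw [h1, one_mul, mul_one]
      _ = Uᴴ * (U * M * Uᴴ) * U := by simp only [mul_assoc]
      _ = r • 1 := by rw [hr, Matrix.mul_smul, Matrix.smul_mul, mul_one, h1]

/-- if every Heisenberg-conjugated Pauli string `U† P U` is a product
operator `X_P ⊗ Y_P` across the bipartition, then `U† = (V ⊗ W)·C` for some local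
unitaries `V, W` and a Clifford unitary `C`. -/
theorem local_clifford_of_product_conjugates {NA NB : ℕ}
    (U : Matrix ((Fin NA → Fin 2) × (Fin NB → Fin 2))
      ((Fin NA → Fin 2) × (Fin NB → Fin 2)) ℂ)
    (hU : U ∈ Matrix.unitaryGroup ((Fin NA → Fin 2) × (Fin NB → Fin 2)) ℂ)
    (hprod : ∀ (a : Fin NA → Fin 4) (b : Fin NB → Fin 4),
      ∃ (X : Matrix (Fin NA → Fin 2) (Fin NA → Fin 2) ℂ)
        (Y : Matrix (Fin NB → Fin 2) (Fin NB → Fin 2) ℂ),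
        Uᴴ * pauliP a b * U = X ⊗ₖ Y) :
    ∃ (V : Matrix (Fin NA → Fin 2) (Fin NA → Fin 2) ℂ)
      (W : Matrix (Fin NB → Fin 2) (Fin NB → Fin 2) ℂ)
      (C : Matrix ((Fin NA → Fin 2) × (Fin NB → Fin 2))
        ((Fin NA → Fin 2) × (Fin NB → Fin 2)) ℂ),
      V ∈ Matrix.unitaryGroup (Fin NA → Fin 2) ℂ ∧
      W ∈ Matrix.unitaryGroup (Fin NB → Fin 2) ℂ ∧
      IsCliffordP C ∧ Uᴴ = (V ⊗ₖ W) * C := by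
  have hQ := pauliP_goodFam U hU hprod
  have h1 : Uᴴ * U = 1 := Matrix.mem_unitaryGroup_iff'.1 hU
  have h2 : U * Uᴴ = 1 := Matrix.mem_unitaryGroup_iff.1 hU
  obtain ⟨S, hS, hSQ⟩ := side_exists hQ
  obtain ⟨S', hS', hSQ'⟩ := side_exists hQ.swap
  obtain ⟨V, hV, hVS⟩ := good_fin hS
  obtain ⟨W, hW, hWS⟩ := good_fin hS'
  have hV1 : Vᴴ * V = 1 := Matrix.mem_unitaryGroup_iff'.1 hV
  have hV2 : V * Vᴴ = 1 := Matrix.mem_unitaryGroup_iff.1 hV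
  have hW1 : Wᴴ * W = 1 := Matrix.mem_unitaryGroup_iff'.1 hW
  have hW2 : W * Wᴴ = 1 := Matrix.mem_unitaryGroup_iff.1 hW
  have hK1 : (V ⊗ₖ W)ᴴ * (V ⊗ₖ W) = 1 := by
    rw [Matrix.conjTranspose_kronecker, ← Matrix.mul_kronecker_mul, hV1, hW1,
      Matrix.one_kronecker_one]
  have hK2 : (V ⊗ₖ W) * (V ⊗ₖ W)ᴴ = 1 := by
    rw [Matrix.conjTranspose_kronecker, ← Matrix.mul_kronecker_mul, hV2, hW2,
      Matrix.one_kronecker_one]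
  set K := V ⊗ₖ W with hK
  have hC : Kᴴ * Uᴴ ∈ Matrix.unitaryGroup ((Fin NA → Fin 2) × (Fin NB → Fin 2)) ℂ := by
    rw [Matrix.mem_unitaryGroup_iff, Matrix.star_eq_conjTranspose, Matrix.conjTranspose_mul,
      Matrix.conjTranspose_conjTranspose, Matrix.conjTranspose_conjTranspose]
    calc _ = Kᴴ * (Uᴴ * U) * K := by simp only [mul_assoc]
      _ = 1 := by rw [h1, mul_one, hK1]
  refine ⟨V, W, Kᴴ * Uᴴ, hV, hW, ⟨hC, fun a b => ?_⟩, ?_⟩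
  · obtain ⟨s, hs, Y, hY⟩ := hSQ (a, b)
    obtain ⟨t, ht, X, hX⟩ := hSQ' (a, b)
    obtain ⟨a', c, rfl⟩ := hVS s hs
    obtain ⟨b', d, rfl⟩ := hWS t ht
    have hX' : Uᴴ * pauliP a b * U = X ⊗ₖ (d • (W * pauliString b' * Wᴴ)) := by
      ext x y
      have := congrFun (congrFun hX x.swap) y.swap
      simp only [Matrix.submatrix_apply, Equiv.prodComm_apply, Prod.swap_swap,
        Matrix.kroneckerMap_apply, Prod.fst_swap, Prod.snd_swap] at this
      rw [this, Matrix.kroneckerMap_apply, mul_comm]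
    have hne : c • (V * pauliString a' * Vᴴ) ≠ 0 := by
      intro h0
      have := hS.sq _ hs
      rw [h0] at this
      simp at this
    obtain ⟨r, hr⟩ := kron_prop' (hY.symm.trans hX') hne
    have hfin : Uᴴ * pauliP a b * U = (c * (r * d)) • (K * pauliP a' b' * Kᴴ) := by
      refine hY.trans ?_
      rw [hr, hK, pauliP, Matrix.conjTranspose_kronecker, ← Matrix.mul_kronecker_mul,
        ← Matrix.mul_kronecker_mul, smul_smul, Matrix.smul_kronecker, Matrix.kronecker_smul,
        smul_smul]
    have hCP : Kᴴ * Uᴴ * pauliP a b * (Kᴴ * Uᴴ)ᴴ = (c * (r * d)) • pauliP a' b' := by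
      rw [Matrix.conjTranspose_mul, Matrix.conjTranspose_conjTranspose,
        Matrix.conjTranspose_conjTranspose]
      calc _ = Kᴴ * (Uᴴ * pauliP a b * U) * K := by simp only [mul_assoc]
        _ = (c * (r * d)) • ((Kᴴ * K) * pauliP a' b' * (Kᴴ * K)) := by
          rw [hfin]; simp only [mul_assoc, Matrix.smul_mul, Matrix.mul_smul]
        _ = _ := by rw [hK1, one_mul, mul_one]
    have hP : ∀ (a : Fin NA → Fin 4) (b : Fin NB → Fin 4), pauliP a b * pauliP a b = 1 := by
      intro a b
      rw [pauliP, ← Matrix.mul_kronecker_mul, ps_sq, ps_sq, Matrix.one_kronecker_one]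
    refine ⟨a', b', _, sign_of_smul ?_ (hP a' b') hCP, hCP⟩
    have hC1 : (Kᴴ * Uᴴ)ᴴ * (Kᴴ * Uᴴ) = 1 := Matrix.mem_unitaryGroup_iff'.1 hC
    have hC2 : (Kᴴ * Uᴴ) * (Kᴴ * Uᴴ)ᴴ = 1 := Matrix.mem_unitaryGroup_iff.1 hC
    generalize Kᴴ * Uᴴ = C at hC1 hC2
    calc _ = C * (pauliP a b * (Cᴴ * C) * pauliP a b) * Cᴴ := by simp only [mul_assoc]
      _ = 1 := by rw [hC1, mul_one, hP, mul_one, hC2]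
  · rw [← mul_assoc, hK2, one_mul]
end

section
/- For any unitary U on N qubits, the Pauli-entangling power is bounded by the average operator nonstabilizerness generated on subsystem-local Pauli strings: P_E(U) ≤ min{ avg over Pauli strings P_A on the A qubits of M_lin(U (P_A ⊗ 1_B) U†), avg over Pauli strings P_B on the B qubits of M_lin(U (1_A ⊗ P_B) U†) }. -/
open Matrix Kronecker

/-- The (real) linear operator entanglement. -/
noncomputable def ElinR {α β : Type*} [Fintype α] [Fintype β] [DecidableEq α] [DecidableEq β]
    (O : Matrix (α × β) (α × β) ℂ) : ℝ :=
  (ElinC O).re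
/-- The linear operator stabilizer entropy
`M_lin(O) = 1 − d⁻⁴ Σ_{P'} |Tr(O P')|⁴`, summing over all `4^N` Pauli strings `P'`
(`+1` phase), `d = 2^N`, `N = N_A + N_B`. -/
noncomputable def MlinP {NA NB : ℕ}
    (O : Matrix ((Fin NA → Fin 2) × (Fin NB → Fin 2))
      ((Fin NA → Fin 2) × (Fin NB → Fin 2)) ℂ) : ℝ :=
  1 - (((2 : ℝ) ^ (NA + NB)) ^ 4)⁻¹ *
    ∑ a : Fin NA → Fin 4, ∑ b : Fin NB → Fin 4, ‖(O * pauliP a b).trace‖ ^ 4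

/-- The (real) Pauli-entangling power: the average linear operator entanglement
generated by `U` on Heisenberg-evolved Pauli strings, averaged over all `4^N` Pauli
strings (`+1` phase), `N = N_A + N_B`. -/
noncomputable def PER {NA NB : ℕ}
    (U : Matrix ((Fin NA → Fin 2) × (Fin NB → Fin 2))
      ((Fin NA → Fin 2) × (Fin NB → Fin 2)) ℂ) : ℝ :=
  ((4 : ℝ) ^ (NA + NB))⁻¹ *
    ∑ a : Fin NA → Fin 4, ∑ b : Fin NB → Fin 4, ElinR (Uᴴ * pauliP a b * U)

structure PB {ι n : Type*} [Fintype ι] [Fintype n] [DecidableEq ι] [DecidableEq n]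
    (P : ι → Matrix n n ℂ) (χ : ι → ι → ℂ) (D : ℂ) : Prop where
  herm : ∀ i, (P i)ᴴ = P i
  conj : ∀ i j, P i * P j * P i = χ i j • P j
  orth : ∀ j k, ∑ i, χ i j * χ i k = if j = k then D ^ 2 else 0
  compl : ∀ x y x' y', ∑ i, P i x y * P i x' y' = if x = y' ∧ y = x' then D else 0

noncomputable def chi1 (i j : Fin 4) : ℂ := if i = 0 ∨ j = 0 ∨ i = j then 1 else -1

lemma PB_pauli : PB pauli chi1 2 where
  herm i := by
    fin_cases i <;> ext x y <;> fin_cases x <;> fin_cases y <;>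
      simp [pauli, Matrix.conjTranspose_apply]
  conj i j := by
    fin_cases i <;> fin_cases j <;> ext x y <;> fin_cases x <;> fin_cases y <;>
      simp [pauli, chi1, Matrix.mul_apply, Fin.sum_univ_two]
  orth j k := by
    fin_cases j <;> fin_cases k <;> simp [chi1, Fin.sum_univ_four] <;> norm_num
  compl x y x' y' := by
    fin_cases x <;> fin_cases y <;> fin_cases x' <;> fin_cases y' <;>
      simp [pauli, Fin.sum_univ_four] <;> norm_num

lemma sum_pi_prod {ι κ : Type*} [Fintype ι] [DecidableEq ι] [Fintype κ] (f : ι → κ → ℂ) :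
    ∑ z : ι → κ, ∏ i, f i (z i) = ∏ i, ∑ k, f i k := by
  rw [Finset.prod_univ_sum, Fintype.piFinset_univ]

lemma prod_ite_all {ι : Type*} [Fintype ι] (p : ι → Prop) [DecidablePred p] (D : ℂ)
    [Decidable (∀ i, p i)] :
    (∏ i, if p i then D else 0) = if ∀ i, p i then D ^ Fintype.card ι else 0 := by
  split_ifs with h
  · simp [h]
  · push Not at h
    obtain ⟨i, hi⟩ := h
    exact Finset.prod_eq_zero (Finset.mem_univ i) (by simp [hi])

lemma pauliString_mul3 {ι : Type*} [Fintype ι] [DecidableEq ι] (a b c : ι → Fin 4) :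
    pauliString a * pauliString b * pauliString c =
      Matrix.of fun x y => ∏ i, (pauli (a i) * pauli (b i) * pauli (c i)) (x i) (y i) := by
  ext x y
  simp only [pauliString, Matrix.mul_apply, Matrix.of_apply, ← Finset.prod_mul_distrib]
  rw [← sum_pi_prod (fun i k => (∑ j, pauli (a i) (x i) j * pauli (b i) j k) * pauli (c i) k (y i))]
  refine Finset.sum_congr rfl fun z _ => ?_
  rw [Finset.prod_mul_distrib,
    ← sum_pi_prod (fun i k => pauli (a i) (x i) k * pauli (b i) k (z i))]

lemma PB_string (ι : Type*) [Fintype ι] [DecidableEq ι] :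
    PB (pauliString (ι := ι)) (fun a b => ∏ i, chi1 (a i) (b i)) (2 ^ Fintype.card ι) where
  herm a := by
    ext x y
    simp only [Matrix.conjTranspose_apply, pauliString, Matrix.of_apply, star_prod]
    refine Finset.prod_congr rfl fun i _ => ?_
    conv_rhs => rw [← PB_pauli.herm (a i)]
    rfl
  conj a b := by
    rw [pauliString_mul3]
    ext x y
    simp only [PB_pauli.conj, Matrix.of_apply, Matrix.smul_apply, smul_eq_mul,
      Finset.prod_mul_distrib, pauliString]
  orth a b := by
    simp only [← Finset.prod_mul_distrib]
    rw [sum_pi_prod (fun i k => chi1 k (a i) * chi1 k (b i))]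
    simp only [PB_pauli.orth]
    rw [prod_ite_all, ← pow_mul, ← pow_mul, mul_comm]
    simp only [funext_iff]
  compl x y x' y' := by
    simp only [pauliString, Matrix.of_apply, ← Finset.prod_mul_distrib]
    rw [sum_pi_prod (fun i k => pauli k (x i) (y i) * pauli k (x' i) (y' i))]
    simp only [PB_pauli.compl]
    rw [prod_ite_all]
    simp only [funext_iff, forall_and]

lemma PB.kron {ι n κ m : Type*} [Fintype ι] [Fintype n] [DecidableEq ι] [DecidableEq n]
    [Fintype κ] [Fintype m] [DecidableEq κ] [DecidableEq m]
    {P : ι → Matrix n n ℂ} {χ : ι → ι → ℂ} {D : ℂ} (h : PB P χ D)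
    {Q : κ → Matrix m m ℂ} {ψ : κ → κ → ℂ} {E : ℂ} (h' : PB Q ψ E) :
    PB (fun p : ι × κ => P p.1 ⊗ₖ Q p.2) (fun p q => χ p.1 q.1 * ψ p.2 q.2) (D * E) where
  herm p := by rw [Matrix.conjTranspose_kronecker, h.herm, h'.herm]
  conj p q := by
    rw [← Matrix.mul_kronecker_mul, ← Matrix.mul_kronecker_mul, h.conj, h'.conj,
      Matrix.smul_kronecker, Matrix.kronecker_smul, smul_smul]
  orth p q := by
    have : ∀ i : ι × κ, χ i.1 p.1 * ψ i.2 p.2 * (χ i.1 q.1 * ψ i.2 q.2) =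
      (χ i.1 p.1 * χ i.1 q.1) * (ψ i.2 p.2 * ψ i.2 q.2) := fun i => by ring
    simp only [this]
    rw [Fintype.sum_prod_type]
    dsimp only
    rw [← Finset.sum_mul_sum, h.orth, h'.orth]
    simp only [Prod.ext_iff, ite_and]
    split_ifs <;> ring
  compl x y x' y' := by
    have : ∀ i : ι × κ, (P i.1 ⊗ₖ Q i.2) x y * (P i.1 ⊗ₖ Q i.2) x' y' =
      (P i.1 x.1 y.1 * P i.1 x'.1 y'.1) * (Q i.2 x.2 y.2 * Q i.2 x'.2 y'.2) := fun i => by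
      simp only [Matrix.kroneckerMap_apply]; ring
    simp only [this]
    rw [Fintype.sum_prod_type]
    dsimp only
    rw [← Finset.sum_mul_sum, h.compl, h'.compl]
    simp only [Prod.ext_iff]
    by_cases h1 : x.1 = y'.1 <;> by_cases h2 : x.2 = y'.2 <;> by_cases h3 : y.1 = x'.1 <;>
      by_cases h4 : y.2 = x'.2 <;> simp [h1, h2, h3, h4]

section
variable {ι n : Type*} [Fintype ι] [Fintype n] [DecidableEq ι] [DecidableEq n]
    {P : ι → Matrix n n ℂ} {χ : ι → ι → ℂ} {D : ℂ}

lemma PB.expand (h : PB P χ D) (M : Matrix n n ℂ) :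
    D • M = ∑ i, (M * P i).trace • P i := by
  ext x y
  simp only [Matrix.smul_apply, Matrix.sum_apply, Matrix.trace, Matrix.diag, Matrix.mul_apply,
    smul_eq_mul, Finset.sum_mul]
  rw [Finset.sum_comm]
  have : ∀ u, ∑ i, ∑ v, M u v * P i v u * P i x y = if u = x then M u y * D else 0 := by
    intro u
    rw [Finset.sum_comm]
    simp only [mul_assoc, ← Finset.mul_sum, h.compl]
    by_cases hu : u = x
    · simp [hu]
    · simp [hu]
  simp only [this]
  simp [mul_comm]

lemma PB.sq_sum (h : PB P χ D) (hD : D ≠ 0) (W : Matrix n n ℂ) :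
    ∑ p, (W * P p * W * P p).trace ^ 2 = ∑ r, (W * P r).trace ^ 4 := by
  have key : ∀ p, D * (W * P p * W * P p).trace = ∑ r, (W * P r).trace ^ 2 * χ p r := by
    intro p
    have : D * (W * P p * W * P p).trace = (W * (P p * (D • W) * P p)).trace := by
      simp [Matrix.mul_assoc]
    rw [this, h.expand W]
    simp only [Matrix.mul_sum, Matrix.sum_mul, Matrix.trace_sum, Matrix.mul_smul, Matrix.smul_mul,
      h.conj, Matrix.trace_smul, smul_eq_mul]
    exact Finset.sum_congr rfl fun r _ => by ring
  have : D ^ 2 * ∑ p, (W * P p * W * P p).trace ^ 2 = D ^ 2 * ∑ r, (W * P r).trace ^ 4 := by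
    simp only [Finset.mul_sum, ← mul_pow, key]
    simp only [sq (∑ r, _), Finset.sum_mul_sum]
    rw [Finset.sum_comm]
    refine Finset.sum_congr rfl fun r _ => ?_
    rw [Finset.sum_comm]
    have : ∀ s, ∑ p, (W * P r).trace ^ 2 * χ p r * ((W * P s).trace ^ 2 * χ p s) =
        if r = s then (W * P r).trace ^ 2 * (W * P s).trace ^ 2 * D ^ 2 else 0 := by
      intro s
      have e : ∀ p, (W * P r).trace ^ 2 * χ p r * ((W * P s).trace ^ 2 * χ p s) =
        (W * P r).trace ^ 2 * (W * P s).trace ^ 2 * (χ p r * χ p s) := fun p => by ring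
      simp only [e, ← Finset.mul_sum, h.orth]
      simp
    simp only [this]
    simp
    ring
  exact mul_left_cancel₀ (pow_ne_zero 2 hD) this
end

section
variable {α β : Type*} [Fintype α] [Fintype β] [DecidableEq α] [DecidableEq β]
  {ι : Type*} [Fintype ι] [DecidableEq ι]

lemma swap_expand (T : Matrix ((α × β) × (α × β)) ((α × β) × (α × β)) ℂ)
    (L : ι → Matrix (α × β) (α × β) ℂ) (D : ℂ)
    (hT : D • T = ∑ k, L k ⊗ₖ L k) (O : Matrix (α × β) (α × β) ℂ) :
    D ^ 2 * (T * (O ⊗ₖ O) * T * (Oᴴ ⊗ₖ Oᴴ)).trace =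
      ∑ k, ∑ l, (L k * O * L l * Oᴴ).trace ^ 2 := by
  have : D ^ 2 * (T * (O ⊗ₖ O) * T * (Oᴴ ⊗ₖ Oᴴ)).trace =
      ((D • T) * (O ⊗ₖ O) * (D • T) * (Oᴴ ⊗ₖ Oᴴ)).trace := by
    simp; ring
  rw [this, hT]
  simp only [Matrix.sum_mul, Matrix.mul_sum, Matrix.trace_sum, ← Matrix.mul_kronecker_mul,
    Matrix.trace_kronecker, ← sq]
  rw [Finset.sum_comm]

lemma swapA_eq {P : ι → Matrix α α ℂ} {χ : ι → ι → ℂ} {D : ℂ} (h : PB P χ D) :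
    D • swapA α β = ∑ k, (P k ⊗ₖ (1 : Matrix β β ℂ)) ⊗ₖ (P k ⊗ₖ (1 : Matrix β β ℂ)) := by
  ext p q
  simp only [Matrix.sum_apply, Matrix.kroneckerMap_apply, Matrix.smul_apply, swapA,
    Matrix.of_apply, smul_eq_mul]
  have e : ∀ k, P k p.1.1 q.1.1 * (1 : Matrix β β ℂ) p.1.2 q.1.2 *
    (P k p.2.1 q.2.1 * (1 : Matrix β β ℂ) p.2.2 q.2.2) = P k p.1.1 q.1.1 * P k p.2.1 q.2.1 *
     ((1 : Matrix β β ℂ) p.1.2 q.1.2 * (1 : Matrix β β ℂ) p.2.2 q.2.2) := fun k => by ring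
  refine Eq.trans ?_ (Finset.sum_congr rfl fun k _ => (e k).symm)
  rw [← Finset.sum_mul, h.compl]
  simp only [Matrix.one_apply]
  clear e
  by_cases h1 : p.1.1 = q.2.1 <;> by_cases h2 : p.2.1 = q.1.1 <;>
    by_cases h3 : p.1.2 = q.1.2 <;> by_cases h4 : p.2.2 = q.2.2 <;>
    simp_all [eq_comm]

lemma swapB_eq {P : ι → Matrix β β ℂ} {χ : ι → ι → ℂ} {D : ℂ} (h : PB P χ D) :
    D • (swapA α β).submatrix id Prod.swap =
      ∑ k, ((1 : Matrix α α ℂ) ⊗ₖ P k) ⊗ₖ ((1 : Matrix α α ℂ) ⊗ₖ P k) := by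
  ext p q
  simp only [Matrix.sum_apply, Matrix.kroneckerMap_apply, Matrix.smul_apply, swapA,
    Matrix.of_apply, smul_eq_mul, Matrix.submatrix_apply, id, Prod.fst_swap, Prod.snd_swap]
  have e : ∀ k, (1 : Matrix α α ℂ) p.1.1 q.1.1 * P k p.1.2 q.1.2 *
    ((1 : Matrix α α ℂ) p.2.1 q.2.1 * P k p.2.2 q.2.2) = P k p.1.2 q.1.2 * P k p.2.2 q.2.2 *
     ((1 : Matrix α α ℂ) p.1.1 q.1.1 * (1 : Matrix α α ℂ) p.2.1 q.2.1) := fun k => by ring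
  refine Eq.trans ?_ (Finset.sum_congr rfl fun k _ => (e k).symm)
  rw [← Finset.sum_mul, h.compl]
  simp only [Matrix.one_apply]
  clear e
  by_cases h1 : p.1.1 = q.1.1 <;> by_cases h2 : p.2.1 = q.2.1 <;>
    by_cases h3 : p.1.2 = q.2.2 <;> by_cases h4 : p.2.2 = q.1.2 <;>
    simp_all [eq_comm]

lemma swapB_conj (O Y : Matrix (α × β) (α × β) ℂ) :
    (swapA α β).submatrix id Prod.swap * (O ⊗ₖ O) * (swapA α β).submatrix id Prod.swap
      = swapA α β * (O ⊗ₖ O) * swapA α β := by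
  have h1 : (swapA α β).submatrix id Prod.swap = (swapA α β).submatrix Prod.swap id := by
    ext p q
    simp only [swapA, Matrix.submatrix_apply, Matrix.of_apply, id, Prod.fst_swap, Prod.snd_swap]
    congr 1
    apply propext
    tauto
  have h2 : (O ⊗ₖ O) = (O ⊗ₖ O).submatrix (Equiv.prodComm (α × β) (α × β))
      (Equiv.prodComm (α × β) (α × β)) := by
    ext p q
    simp [mul_comm]
  conv_lhs => 
    rw [h2]
    arg 2
    rw [h1]
  change (swapA α β).submatrix id (Equiv.prodComm (α × β) (α × β)) * _ *
    (swapA α β).submatrix (Equiv.prodComm (α × β) (α × β)) id = _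
  rw [Matrix.submatrix_mul_equiv, Matrix.submatrix_mul_equiv]
  rfl
end

lemma im_zero_of_conj {z : ℂ} (h : star z = z) : z.im = 0 :=
  Complex.conj_eq_iff_im.1 h

lemma trace4_real {n : Type*} [Fintype n] (A B O : Matrix n n ℂ) (hA : Aᴴ = A) (hB : Bᴴ = B) :
    star (A * O * B * Oᴴ).trace = (A * O * B * Oᴴ).trace := by
  rw [← Matrix.trace_conjTranspose]
  simp only [Matrix.conjTranspose_mul, Matrix.conjTranspose_conjTranspose, hA, hB]
  rw [← Matrix.mul_assoc, ← Matrix.mul_assoc, Matrix.trace_mul_comm]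
  simp only [Matrix.mul_assoc]

lemma trace2_real {n : Type*} [Fintype n] (A B : Matrix n n ℂ) (hA : Aᴴ = A) (hB : Bᴴ = B) :
    star (A * B).trace = (A * B).trace := by
  rw [← Matrix.trace_conjTranspose]
  simp only [Matrix.conjTranspose_mul, hA, hB]
  rw [Matrix.trace_mul_comm]

lemma re_sq_nonneg {z : ℂ} (h : star z = z) : 0 ≤ (z ^ 2).re := by
  have := im_zero_of_conj h
  rw [sq, Complex.mul_re, this]
  nlinarith [sq_nonneg z.re]

lemma re_pow_four {z : ℂ} (h : star z = z) : (z ^ 4).re = ‖z‖ ^ 4 := by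
  have h1 : z = (z.re : ℂ) := Complex.ext (by simp) (by simp [im_zero_of_conj h])
  rw [h1]
  rw [← Complex.ofReal_pow, Complex.ofReal_re, Complex.norm_real, Real.norm_eq_abs]
  exact (Even.pow_abs (by decide) _).symm

lemma main_bound {NA NB M : ℕ}
    (U : Matrix ((Fin NA → Fin 2) × (Fin NB → Fin 2))
      ((Fin NA → Fin 2) × (Fin NB → Fin 2)) ℂ)
    (T : Matrix (((Fin NA → Fin 2) × (Fin NB → Fin 2)) × ((Fin NA → Fin 2) × (Fin NB → Fin 2)))
      (((Fin NA → Fin 2) × (Fin NB → Fin 2)) × ((Fin NA → Fin 2) × (Fin NB → Fin 2))) ℂ)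
    (L : (Fin M → Fin 4) → Matrix ((Fin NA → Fin 2) × (Fin NB → Fin 2))
      ((Fin NA → Fin 2) × (Fin NB → Fin 2)) ℂ)
    (hL : ∀ k, (L k)ᴴ = L k)
    (hT : ((2 : ℂ) ^ M) • T = ∑ k, L k ⊗ₖ L k)
    (hTA : ∀ O : Matrix ((Fin NA → Fin 2) × (Fin NB → Fin 2))
      ((Fin NA → Fin 2) × (Fin NB → Fin 2)) ℂ, T * (O ⊗ₖ O) * T = swapA _ _ * (O ⊗ₖ O) * swapA _ _) :
    PER U ≤ ((4 : ℝ) ^ M)⁻¹ * ∑ k, MlinP (U * L k * Uᴴ) := by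
  have hPB : PB (fun p : (Fin NA → Fin 4) × (Fin NB → Fin 4) => pauliP p.1 p.2) _ _ :=
    (PB_string (Fin NA)).kron (PB_string (Fin NB))
  have hE : ∀ O : Matrix ((Fin NA → Fin 2) × (Fin NB → Fin 2))
      ((Fin NA → Fin 2) × (Fin NB → Fin 2)) ℂ,
      ElinR O ≤ 1 - ((4 : ℝ) ^ (NA + NB))⁻¹ * (((4 : ℝ) ^ M)⁻¹ *
        ∑ k, ((L k * O * L k * Oᴴ).trace ^ 2).re) := by
    intro O
    have h1 := swap_expand T L _ hT O
    rw [hTA] at h1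
    set F := (swapA _ _ * (O ⊗ₖ O) * swapA _ _ * (Oᴴ ⊗ₖ Oᴴ)).trace with hF
    have h2 : (4 : ℝ) ^ M * F.re = ∑ k, ∑ l, ((L k * O * L l * Oᴴ).trace ^ 2).re := by
      have := congrArg Complex.re h1
      simp only [Complex.re_sum] at this
      rw [← this]
      have e : ((2 : ℂ) ^ M) ^ 2 = (((4 : ℝ) ^ M : ℝ) : ℂ) := by
        rw [← pow_mul, mul_comm, pow_mul]; push_cast; norm_num
      rw [e, Complex.re_ofReal_mul]
    have h3 : ∑ k, ((L k * O * L k * Oᴴ).trace ^ 2).re ≤ (4 : ℝ) ^ M * F.re := by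
      rw [h2]
      refine Finset.sum_le_sum fun k _ => ?_
      exact Finset.single_le_sum (f := fun l => ((L k * O * L l * Oᴴ).trace ^ 2).re)
        (fun l _ => re_sq_nonneg (trace4_real _ _ _ (hL k) (hL l))) (Finset.mem_univ k)
    have h4 : ElinR O = 1 - ((4 : ℝ) ^ (NA + NB))⁻¹ * F.re := by
      unfold ElinR ElinC
      rw [← hF]
      have e : ((((Fintype.card (Fin NA → Fin 2) : ℕ) : ℂ) *
          ((Fintype.card (Fin NB → Fin 2) : ℕ) : ℂ)) ^ 2)⁻¹ =
          ((((4 : ℝ) ^ (NA + NB))⁻¹ : ℝ) : ℂ) := by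
        simp only [Fintype.card_pi, Fintype.card_fin, Finset.prod_const, Finset.card_univ]
        push_cast
        rw [← pow_add, ← pow_mul, mul_comm, pow_mul]; norm_num
      rw [e, Complex.sub_re, Complex.re_ofReal_mul, Complex.one_re]
    rw [h4]
    have h5 : ((4 : ℝ) ^ M)⁻¹ * ∑ k, ((L k * O * L k * Oᴴ).trace ^ 2).re ≤ F.re := by
      rw [inv_mul_le_iff₀ (by positivity)]; exact h3
    have : (0 : ℝ) ≤ ((4 : ℝ) ^ (NA + NB))⁻¹ := by positivity
    nlinarith [mul_le_mul_of_nonneg_left h5 this]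
  have hS : ∀ k, ∑ a : Fin NA → Fin 4, ∑ b : Fin NB → Fin 4,
      ((L k * (Uᴴ * pauliP a b * U) * L k * (Uᴴ * pauliP a b * U)ᴴ).trace ^ 2).re =
      ∑ a : Fin NA → Fin 4, ∑ b : Fin NB → Fin 4, ‖((U * L k * Uᴴ) * pauliP a b).trace‖ ^ 4 := by
    intro k
    have h1 := congrArg Complex.re (hPB.sq_sum (by simp) (U * L k * Uᴴ))
    simp only [Complex.re_sum, Fintype.sum_prod_type] at h1
    have hH : (U * L k * Uᴴ)ᴴ = U * L k * Uᴴ := by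
      simp [Matrix.conjTranspose_mul, hL, Matrix.mul_assoc]
    have hp : ∀ (a : Fin NA → Fin 4) (b : Fin NB → Fin 4), (pauliP a b)ᴴ = pauliP a b :=
      fun a b => hPB.herm (a, b)
    refine Eq.trans ?_ (h1.trans ?_)
    · refine Finset.sum_congr rfl fun a _ => Finset.sum_congr rfl fun b _ => ?_
      refine congrArg (fun z : ℂ => (z ^ 2).re) ?_
      simp only [Matrix.conjTranspose_mul, Matrix.conjTranspose_conjTranspose, hp,
        Matrix.mul_assoc]
      rw [Matrix.trace_mul_comm U]
      simp only [Matrix.mul_assoc]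
    · refine Finset.sum_congr rfl fun a _ => Finset.sum_congr rfl fun b _ => ?_
      exact re_pow_four (trace2_real _ _ hH (hp a b))
  have hcard : ∀ m : ℕ, (Fintype.card (Fin m → Fin 4) : ℝ) = 4 ^ m := by
    intro m; simp
  calc PER U ≤ ((4 : ℝ) ^ (NA + NB))⁻¹ * ∑ a : Fin NA → Fin 4, ∑ b : Fin NB → Fin 4,
        (1 - ((4 : ℝ) ^ (NA + NB))⁻¹ * (((4 : ℝ) ^ M)⁻¹ *
        ∑ k, ((L k * (Uᴴ * pauliP a b * U) * L k * (Uᴴ * pauliP a b * U)ᴴ).trace ^ 2).re)) := by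
        unfold PER
        gcongr
        exact hE _
    _ = 1 - ((4 : ℝ) ^ (NA + NB))⁻¹ * (((4 : ℝ) ^ (NA + NB))⁻¹ * (((4 : ℝ) ^ M)⁻¹ *
        ∑ k, ∑ a : Fin NA → Fin 4, ∑ b : Fin NB → Fin 4,
          ‖((U * L k * Uᴴ) * pauliP a b).trace‖ ^ 4)) := by
        simp only [← hS]
        simp only [Finset.sum_sub_distrib, ← Finset.mul_sum, Finset.sum_const, Finset.card_univ,
          nsmul_eq_mul, hcard, mul_one, mul_sub]
        congr 1
        · rw [← pow_add, inv_mul_cancel₀ (by positivity)]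
        · congr 3
          rw [Finset.sum_comm]
          rw [Finset.sum_comm]
          conv_rhs => rw [Finset.sum_comm]
          exact Finset.sum_congr rfl fun a _ => Finset.sum_comm
    _ = _ := by
        unfold MlinP
        simp only [Finset.sum_sub_distrib, ← Finset.mul_sum, Finset.sum_const, Finset.card_univ,
          nsmul_eq_mul, hcard, mul_one, mul_sub]
        have e : (((2 : ℝ) ^ (NA + NB)) ^ 4) = 4 ^ (NA + NB) * 4 ^ (NA + NB) := by
          rw [← mul_pow, ← pow_mul, mul_comm, pow_mul]; norm_num
        rw [e, inv_mul_cancel₀ (by positivity), mul_inv]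
        ring

/-- the Pauli-entangling power of `U` is bounded by the average
operator nonstabilizerness generated by the inverse Heisenberg evolution on
subsystem-local Pauli strings `P_A ⊗ 1_B` (resp. `1_A ⊗ P_B`). -/
theorem PER_le_local_Mlin {NA NB : ℕ}
    (U : Matrix ((Fin NA → Fin 2) × (Fin NB → Fin 2))
      ((Fin NA → Fin 2) × (Fin NB → Fin 2)) ℂ)
    (hU : U ∈ Matrix.unitaryGroup ((Fin NA → Fin 2) × (Fin NB → Fin 2)) ℂ) :
    PER U ≤ min
      (((4 : ℝ) ^ NA)⁻¹ * ∑ a : Fin NA → Fin 4,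
        MlinP (U * (pauliString a ⊗ₖ (1 : Matrix (Fin NB → Fin 2) (Fin NB → Fin 2) ℂ)) * Uᴴ))
      (((4 : ℝ) ^ NB)⁻¹ * ∑ b : Fin NB → Fin 4,
        MlinP (U * ((1 : Matrix (Fin NA → Fin 2) (Fin NA → Fin 2) ℂ) ⊗ₖ pauliString b) * Uᴴ)) := by
  refine le_min ?_ ?_
  · have h := PB_string (Fin NA)
    rw [Fintype.card_fin] at h
    refine main_bound U (swapA _ _) _ (fun k => ?_) (swapA_eq h) (fun _ => rfl)
    rw [Matrix.conjTranspose_kronecker, h.herm, Matrix.conjTranspose_one]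
  · have h := PB_string (Fin NB)
    rw [Fintype.card_fin] at h
    refine main_bound U ((swapA _ _).submatrix id Prod.swap) _ (fun k => ?_) (swapB_eq h)
      (fun O => swapB_conj O O)
    rw [Matrix.conjTranspose_kronecker, h.herm, Matrix.conjTranspose_one]
end
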